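/- (Theorem 3.2, Uniform Comparison Theorem) Write χ(A_g, t) = Σ_{k≥0} (−1)^k a_k(g) t^{n−k}, so a_k(g) = (−1)^k times the coefficient of t^{n−k} in the characteristic polynomial of A_g. If g, h ∈ F^m satisfy C_h ⊆ C_g, then a_k(g) ≤ a_k(h) for every k ≥ 0. -/

import Mathlib

open Matrix

variable {F : Type*} [Field F] {m n : ℕ}

/-- The subsystem `[A|J] x = [g|J]` is consistent. -/
def Consistent (A : Matrix (Fin m) (Fin n) F) (J : Finset (Fin m)) (g : Fin m → F) : Prop :=
  ∃ x : Fin n → F, ∀ j ∈ J, A j ⬝ᵥ x = g j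

/-- `I` is a circuit of the matroid represented by the rows of `A`: the rows indexed by `I`
are linearly dependent, but the rows indexed by any proper subset are linearly independent. -/
def IsCircuit (A : Matrix (Fin m) (Fin n) F) (I : Finset (Fin m)) : Prop :=
  ¬ LinearIndependent F (fun i : ↥I => A (i : Fin m)) ∧
    ∀ J : Finset (Fin m), J ⊂ I → LinearIndependent F (fun j : ↥J => A (j : Fin m))

/-- `c` is a circuit vector of the circuit `I`: `c · A = 0`, the entries of `c` indexed by `I`
are nonzero, and all other entries vanish. -/
def IsCircuitVector (A : Matrix (Fin m) (Fin n) F) (I : Finset (Fin m)) (c : Fin m → F) : Prop :=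
  Matrix.vecMul c A = 0 ∧ (∀ i ∈ I, c i ≠ 0) ∧ (∀ i ∉ I, c i = 0)
/-- `I_g`: the collection of index sets `J` for which `[A|J] x = [g|J]` is consistent. -/
def Iset (A : Matrix (Fin m) (Fin n) F) (g : Fin m → F) : Set (Finset (Fin m)) :=
  {J | Consistent A J g}

/-- `C_g = I_g ∩ C(M)`: the circuits whose subsystem is consistent. -/
def Cset (A : Matrix (Fin m) (Fin n) F) (g : Fin m → F) : Set (Finset (Fin m)) :=
  Iset A g ∩ {I | IsCircuit A I}

/-- The intersection poset of the arrangement `{H i}` of hyperplanes of the ambient space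
`V`: `V` together with all nonempty intersections of subfamilies, i.e. the collection of
nonempty sets of the form `V ∩ ⋂ i ∈ S, H i` (the empty subfamily `S = ∅` yields `V`);
it is ordered by reverse inclusion. -/
def flats {E ι : Type*} (V : Set E) (H : ι → Set E) : Set (Set E) :=
  {W | (∃ S : Set ι, W = V ∩ ⋂ i ∈ S, H i) ∧ W.Nonempty}

lemma flats_finite {E ι : Type*} [Finite ι] (V : Set E) (H : ι → Set E) :
    (flats V H).Finite := by
  have hsub : flats V H ⊆ (fun S : Set ι => V ∩ ⋂ i ∈ S, H i) '' Set.univ := by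
    rintro W ⟨⟨S, rfl⟩, -⟩
    exact ⟨S, Set.mem_univ _, rfl⟩
  exact (Set.finite_univ.image _).subset hsub

lemma self_mem_flats {E ι : Type*} {V : Set E} (H : ι → Set E) (hV : V.Nonempty) :
    V ∈ flats V H :=
  ⟨⟨∅, by simp⟩, hV⟩

/-- The dimension of a subset of an `F`-vector space: the dimension of the direction of its
affine span. -/
noncomputable def adim (F : Type*) [Field F] {E : Type*} [AddCommGroup E] [Module F E]
    (W : Set E) : ℕ :=
  Module.finrank F (affineSpan F W).direction

open Classical in
/-- The characteristic polynomial `χ(B, t) = ∑_{W ∈ L(B)} μ(V, W) t^(dim W)` of the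
arrangement `B = {H i}` of hyperplanes of the ambient space `V`, where `μ` is the Möbius
function of the intersection poset `L(B)` ordered by reverse inclusion (so the Möbius value
`μ(V, W)` of the reverse-inclusion poset is `IncidenceAlgebra.mu` from `W` to `V` in the
inclusion order). -/
noncomputable def chi (F : Type*) [Field F] {E ι : Type*} [AddCommGroup E] [Module F E]
    [Finite ι] (V : Set E) (H : ι → Set E) : Polynomial ℤ :=
  letI : Fintype ↥(flats V H) := (flats_finite V H).fintype
  letI : LocallyFiniteOrder ↥(flats V H) := Fintype.toLocallyFiniteOrder
  if hV : V.Nonempty then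
    ∑ W : ↥(flats V H),
      Polynomial.C (IncidenceAlgebra.mu ℤ W (⟨V, self_mem_flats H hV⟩ : ↥(flats V H))) *
        Polynomial.X ^ adim F (W : Set E)
  else 0

/-- The affine hyperplane `H_{ρ_i, g_i} = {x ∈ F^n : ρ_i · x = g_i}` of the arrangement
`A_g`. -/
def Haff (A : Matrix (Fin m) (Fin n) F) (g : Fin m → F) (i : Fin m) : Set (Fin n → F) :=
  {x | A i ⬝ᵥ x = g i}

section Helpers

/-- Independent sets without broken consistent circuits. -/
def IsNBC (A : Matrix (Fin m) (Fin n) F) (g : Fin m → F) (S : Finset (Fin m)) : Prop :=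
  LinearIndependent F (fun i : ↥S => A (i : Fin m)) ∧
    ∀ C ∈ Cset A g, ∀ e ∈ C, (∀ j ∈ C, e ≤ j) → ¬ C.erase e ⊆ S

lemma linInd_mono (A : Matrix (Fin m) (Fin n) F) {S T : Finset (Fin m)} (hST : S ⊆ T)
    (hT : LinearIndependent F (fun i : ↥T => A (i : Fin m))) :
    LinearIndependent F (fun i : ↥S => A (i : Fin m)) := by
  have h1 : LinearIndepOn F (fun i => A i) (T : Set (Fin m)) := hT
  have h2 : LinearIndepOn F (fun i => A i) (S : Set (Fin m)) :=
    h1.mono (by exact_mod_cast hST)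
  exact h2

lemma IsNBC.mono {A : Matrix (Fin m) (Fin n) F} {g : Fin m → F} {S T : Finset (Fin m)}
    (hT : IsNBC A g T) (hST : S ⊆ T) : IsNBC A g S :=
  ⟨linInd_mono A hST hT.1, fun C hC e he hmin hsub => hT.2 C hC e he hmin (hsub.trans hST)⟩

lemma exists_circuit (A : Matrix (Fin m) (Fin n) F) (S : Finset (Fin m))
    (hS : ¬ LinearIndependent F (fun i : ↥S => A (i : Fin m))) :
    ∃ C ⊆ S, IsCircuit A C := by
  induction S using Finset.strongInduction with
  | H S ih =>
    by_cases hh : ∀ J : Finset (Fin m), J ⊂ S → LinearIndependent F (fun j : ↥J => A (j : Fin m))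
    · exact ⟨S, subset_rfl, hS, hh⟩
    · push Not at hh
      obtain ⟨J, hJS, hJ⟩ := hh
      obtain ⟨C, hCJ, hC⟩ := ih J hJS hJ
      exact ⟨C, hCJ.trans hJS.subset, hC⟩

lemma circuit_closure (A : Matrix (Fin m) (Fin n) F) (g : Fin m → F) {C : Finset (Fin m)}
    (hC : C ∈ Cset A g) {e : Fin m} (he : e ∈ C) (x : Fin n → F)
    (hx : ∀ j ∈ C.erase e, A j ⬝ᵥ x = g j) : A e ⬝ᵥ x = g e := by
  obtain ⟨⟨y, hy⟩, hdep, hind⟩ := hC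
  have hi : LinearIndepOn F (fun i => A i) ((C.erase e : Finset (Fin m)) : Set (Fin m)) :=
    hind _ (Finset.erase_ssubset he)
  have hd : ¬ LinearIndepOn F (fun i => A i) (C : Set (Fin m)) := hdep
  rw [← Finset.insert_erase he, Finset.coe_insert,
    linearIndepOn_insert (by simp)] at hd
  have hspan : A e ∈ Submodule.span F
      ((fun i => A i) '' ((C.erase e : Finset (Fin m)) : Set (Fin m))) := by
    by_contra hcon
    exact hd ⟨hi, hcon⟩
  have key : ∀ v ∈ Submodule.span F
      ((fun i => A i) '' ((C.erase e : Finset (Fin m)) : Set (Fin m))), v ⬝ᵥ x = v ⬝ᵥ y := by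
    intro v hv
    induction hv using Submodule.span_induction with
    | mem v hv =>
      obtain ⟨j, hj, rfl⟩ := hv
      have hj' : j ∈ C.erase e := by exact_mod_cast hj
      show A j ⬝ᵥ x = A j ⬝ᵥ y
      rw [hx j hj', hy j (Finset.mem_of_mem_erase hj')]
    | zero => simp
    | add u v _ _ hu hv => rw [add_dotProduct, add_dotProduct, hu, hv]
    | smul a v _ hv => rw [smul_dotProduct, smul_dotProduct, hv]
  rw [key _ hspan, hy e he]

lemma IsNBC.insert_min {A : Matrix (Fin m) (Fin n) F} {g : Fin m → F} {S : Finset (Fin m)}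
    (hS : IsNBC A g S) {W : Set (Fin n → F)} (hW : W.Nonempty) {e : Fin m}
    (he : W ⊆ Haff A g e) (hmin : ∀ j, W ⊆ Haff A g j → e ≤ j)
    (hSW : ∀ i ∈ S, W ⊆ Haff A g i) : IsNBC A g (insert e S) := by
  have hSW' : ∀ i ∈ insert e S, W ⊆ Haff A g i := by
    intro i hi
    rcases Finset.mem_insert.1 hi with rfl | hi
    · exact he
    · exact hSW i hi
  have hnb : ∀ C ∈ Cset A g, ∀ f ∈ C, (∀ j ∈ C, f ≤ j) → ¬ C.erase f ⊆ insert e S := by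
    intro C hC f hf hfmin hsub
    have hfW : W ⊆ Haff A g f := fun x hx =>
      circuit_closure A g hC hf x (fun j hj => hSW' j (hsub hj) hx)
    refine hS.2 C hC f hf hfmin (fun j hj => ?_)
    rcases Finset.mem_insert.1 (hsub hj) with rfl | h
    · exact absurd (le_antisymm (hmin f hfW) (hfmin j (Finset.mem_of_mem_erase hj)))
        (Finset.ne_of_mem_erase hj)
    · exact h
  refine ⟨?_, hnb⟩
  by_contra hdep
  obtain ⟨C, hCS, hC⟩ := exists_circuit A _ hdep
  have hCne : C.Nonempty := by
    rw [Finset.nonempty_iff_ne_empty]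
    rintro rfl
    exact hC.1 linearIndependent_empty_type
  obtain ⟨x, hx⟩ := hW
  exact hnb C ⟨⟨x, fun j hj => hSW' j (hCS hj) hx⟩, hC⟩ (C.min' hCne) (C.min'_mem hCne)
    (fun j hj => C.min'_le j hj) ((Finset.erase_subset _ _).trans hCS)

lemma Haff_ne_univ (A : Matrix (Fin m) (Fin n) F) (hrows : ∀ i, A i ≠ 0) (g : Fin m → F)
    (i : Fin m) : ¬ Set.univ ⊆ Haff A g i := by
  intro hu
  have h0 : g i = 0 := by
    have : A i ⬝ᵥ 0 = g i := hu (Set.mem_univ 0)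
    simpa using this.symm
  apply hrows i
  apply dotProduct_eq_zero
  intro x
  have : A i ⬝ᵥ x = g i := hu (Set.mem_univ x)
  rw [this, h0]

lemma isNBC_empty (A : Matrix (Fin m) (Fin n) F) (hrows : ∀ i, A i ≠ 0) (g : Fin m → F) :
    IsNBC A g ∅ := by
  refine ⟨linearIndependent_empty_type, ?_⟩
  intro C hC e he _ hsub
  apply Haff_ne_univ A hrows g e
  intro x _
  refine circuit_closure A g hC he x (fun j hj => ?_)
  exact absurd (hsub hj) (Finset.notMem_empty j)

/-- intersection of the hyperplanes indexed by `S`. -/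
def flatOf (A : Matrix (Fin m) (Fin n) F) (g : Fin m → F) (S : Finset (Fin m)) :
    Set (Fin n → F) := Set.univ ∩ ⋂ i ∈ (S : Set (Fin m)), Haff A g i

lemma mem_flatOf {A : Matrix (Fin m) (Fin n) F} {g : Fin m → F} {S : Finset (Fin m)}
    {x : Fin n → F} : x ∈ flatOf A g S ↔ ∀ i ∈ S, A i ⬝ᵥ x = g i := by
  simp [flatOf, Haff]

open Classical in
lemma sum_nbc (A : Matrix (Fin m) (Fin n) F) (hrows : ∀ i, A i ≠ 0) (g : Fin m → F)
    (W : Set (Fin n → F)) (hW : W ∈ flats Set.univ (Haff A g)) :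
    ∑ S ∈ (Finset.univ : Finset (Finset (Fin m))).filter
      (fun S => IsNBC A g S ∧ ∀ i ∈ S, W ⊆ Haff A g i), (-1 : ℤ) ^ S.card =
      if W = Set.univ then 1 else 0 := by
  split_ifs with hWV
  · subst hWV
    rw [Finset.sum_eq_single_of_mem ∅]
    · simp
    · simp [isNBC_empty A hrows g]
    · intro S hS hne
      obtain ⟨i, hi⟩ := Finset.nonempty_iff_ne_empty.2 hne
      exact absurd ((Finset.mem_filter.1 hS).2.2 i hi) (Haff_ne_univ A hrows g i)
  · obtain ⟨⟨T, hT⟩, hne⟩ := hW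
    let X : Finset (Fin m) := Finset.univ.filter (fun i => W ⊆ Haff A g i)
    have hX : X.Nonempty := by
      by_contra hXe
      apply hWV
      have hTe : T = ∅ := by
        by_contra hTne
        obtain ⟨i, hi⟩ := Set.nonempty_iff_ne_empty.2 hTne
        apply hXe
        refine ⟨i, Finset.mem_filter.2 ⟨Finset.mem_univ _, ?_⟩⟩
        rw [hT]
        exact Set.inter_subset_right.trans (Set.biInter_subset_of_mem hi)
      rw [hT, hTe]; simp
    have heX := X.min'_mem hX
    have hemin : ∀ j, W ⊆ Haff A g j → X.min' hX ≤ j := fun j hj =>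
      X.min'_le j (Finset.mem_filter.2 ⟨Finset.mem_univ _, hj⟩)
    generalize X.min' hX = e at heX hemin
    have he : W ⊆ Haff A g e := (Finset.mem_filter.1 heX).2
    refine Finset.sum_involution (fun S _ => if e ∈ S then S.erase e else insert e S)
      ?_ ?_ ?_ ?_
    · intro S _
      split_ifs with heS
      · rw [← Finset.card_erase_add_one heS, pow_succ]; ring
      · rw [Finset.card_insert_of_notMem heS, pow_succ]; ring
    · intro S _ _
      split_ifs with heS
      · intro hh; rw [← hh] at heS; exact absurd heS (Finset.notMem_erase e S)
      · intro hh; apply heS; rw [← hh]; exact Finset.mem_insert_self e S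
    · intro S hS
      obtain ⟨-, h1, h2⟩ := Finset.mem_filter.1 hS
      refine Finset.mem_filter.2 ⟨Finset.mem_univ _, ?_⟩
      split_ifs with heS
      · exact ⟨h1.mono (Finset.erase_subset _ _), fun i hi => h2 i (Finset.mem_of_mem_erase hi)⟩
      · refine ⟨h1.insert_min hne he hemin h2, fun i hi => ?_⟩
        rcases Finset.mem_insert.1 hi with rfl | hi
        · exact he
        · exact h2 i hi
    · intro S _
      by_cases heS : e ∈ S
      · simp [heS, Finset.insert_erase]
      · simp [heS]

lemma nbc_geom (A : Matrix (Fin m) (Fin n) F) (g : Fin m → F) (S : Finset (Fin m))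
    (hS : LinearIndependent F (fun i : ↥S => A (i : Fin m))) :
    (flatOf A g S).Nonempty ∧ adim F (flatOf A g S) + S.card = n := by
  let M : Matrix ↥S (Fin n) F := fun i => A i
  have hrank : M.rank = S.card := by
    have := LinearIndependent.rank_matrix (M := M) hS
    simpa using this
  have hfr : Module.finrank F (LinearMap.range M.mulVecLin) = S.card := hrank
  have htop : LinearMap.range M.mulVecLin = ⊤ := by
    apply Submodule.eq_top_of_finrank_eq
    rw [hfr]; simp
  obtain ⟨x, hx⟩ : ∃ x, M.mulVecLin x = fun i : ↥S => g i :=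
    LinearMap.range_eq_top.1 htop _
  have hxm : x ∈ flatOf A g S := by
    rw [mem_flatOf]
    intro i hi
    exact congrFun hx ⟨i, hi⟩
  refine ⟨⟨x, hxm⟩, ?_⟩
  have hdir : (affineSpan F (flatOf A g S)).direction = LinearMap.ker M.mulVecLin := by
    rw [direction_affineSpan]
    apply le_antisymm
    · rw [vectorSpan_def, Submodule.span_le]
      rintro _ ⟨u, hu, v, hv, rfl⟩
      rw [mem_flatOf] at hu hv
      show M.mulVecLin (u - v) = 0
      rw [map_sub, sub_eq_zero]
      funext i
      show A i ⬝ᵥ u = A i ⬝ᵥ v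
      rw [hu i i.2, hv i i.2]
    · intro v hv
      have hv' : ∀ i ∈ S, A i ⬝ᵥ v = 0 := fun i hi => congrFun hv ⟨i, hi⟩
      have h1 : x + v ∈ flatOf A g S := by
        rw [mem_flatOf] at hxm ⊢
        intro i hi
        rw [dotProduct_add, hxm i hi, hv' i hi, add_zero]
      have := vsub_mem_vectorSpan F h1 hxm
      simpa using this
  have := LinearMap.finrank_range_add_finrank_ker M.mulVecLin
  rw [hfr, ← hdir, Module.finrank_fin_fun] at this
  unfold adim
  omega

lemma nbc_flat {A : Matrix (Fin m) (Fin n) F} {g : Fin m → F} {S : Finset (Fin m)}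
    (hS : IsNBC A g S) : flatOf A g S ∈ flats Set.univ (Haff A g) :=
  ⟨⟨S, rfl⟩, (nbc_geom A g S hS.1).1⟩

open Classical in
lemma sum_fiber (A : Matrix (Fin m) (Fin n) F) (g : Fin m → F)
    (s : Finset ↥(flats Set.univ (Haff A g))) (φ : Set (Fin n → F) → Finset (Fin m) → ℤ) :
    ∑ W ∈ s, ∑ S ∈ (Finset.univ : Finset (Finset (Fin m))).filter
      (fun S => IsNBC A g S ∧ flatOf A g S = (W : Set (Fin n → F))), φ W S =
    ∑ S ∈ (Finset.univ : Finset (Finset (Fin m))).filter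
      (fun S => IsNBC A g S ∧ ∃ W ∈ s, flatOf A g S = (W : Set (Fin n → F))),
      φ (flatOf A g S) S := by
  simp_rw [Finset.sum_filter]
  rw [Finset.sum_comm]
  refine Finset.sum_congr rfl (fun S _ => ?_)
  by_cases hh : IsNBC A g S ∧ ∃ W ∈ s, flatOf A g S = (W : Set (Fin n → F))
  · rw [if_pos hh]
    obtain ⟨h1, W, hW, hSW⟩ := hh
    rw [Finset.sum_eq_single_of_mem W hW]
    · rw [if_pos ⟨h1, hSW⟩, hSW]
    · intro W' _ hne
      rw [if_neg]
      rintro ⟨-, h2⟩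
      exact hne (Subtype.ext (h2.symm.trans hSW))
  · rw [if_neg hh]
    refine Finset.sum_eq_zero (fun W hW => ?_)
    rw [if_neg]
    rintro ⟨h1, h2⟩
    exact hh ⟨h1, W, hW, h2⟩

open Classical in
lemma mu_eq (A : Matrix (Fin m) (Fin n) F) (hrows : ∀ i, A i ≠ 0) (g : Fin m → F)
    [LocallyFiniteOrder ↥(flats Set.univ (Haff A g))]
    (V : ↥(flats Set.univ (Haff A g))) (hV : (V : Set (Fin n → F)) = Set.univ)
    (W : ↥(flats Set.univ (Haff A g))) :
    IncidenceAlgebra.mu ℤ W V =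
      ∑ S ∈ (Finset.univ : Finset (Finset (Fin m))).filter
        (fun S => IsNBC A g S ∧ flatOf A g S = (W : Set (Fin n → F))), (-1 : ℤ) ^ S.card := by
  have : Finite ↥(flats Set.univ (Haff A g)) := (flats_finite Set.univ (Haff A g)).to_subtype
  induction W using WellFoundedGT.induction with
  | ind W ih =>
    have hWV : W ≤ V := by
      show (W : Set (Fin n → F)) ⊆ V
      rw [hV]; exact Set.subset_univ _
    have h1 := IncidenceAlgebra.sum_Icc_mu_left (𝕜 := ℤ) W V
    have h2 := sum_fiber A g (Finset.Icc W V) (fun _ S => (-1 : ℤ) ^ S.card)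
    have h3 := sum_nbc A hrows g W W.2
    have h4 : (Finset.univ : Finset (Finset (Fin m))).filter
      (fun S => IsNBC A g S ∧ ∃ W' ∈ Finset.Icc W V, flatOf A g S = (W' : Set (Fin n → F))) =
      (Finset.univ : Finset (Finset (Fin m))).filter
      (fun S => IsNBC A g S ∧ ∀ i ∈ S, (W : Set (Fin n → F)) ⊆ Haff A g i) := by
      refine Finset.filter_congr (fun S _ => and_congr_right (fun hS => ?_))
      constructor
      · rintro ⟨W', hW', hSW⟩ i hi x hx
        have : x ∈ flatOf A g S := by
          rw [hSW]; exact (Finset.mem_Icc.1 hW').1 hx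
        exact mem_flatOf.1 this i hi
      · intro hh
        refine ⟨⟨flatOf A g S, nbc_flat hS⟩, Finset.mem_Icc.2 ⟨?_, ?_⟩, rfl⟩
        · intro x hx
          exact mem_flatOf.2 (fun i hi => hh i hi hx)
        · show flatOf A g S ⊆ V
          rw [hV]; exact Set.subset_univ _
    have hiff : (W = V) ↔ ((W : Set (Fin n → F)) = Set.univ) := by
      rw [Subtype.ext_iff]
      exact ⟨fun h => h.trans hV, fun h => h.trans hV.symm⟩
    simp only [h4, h3] at h2
    have h5 : ∑ W' ∈ Finset.Icc W V, IncidenceAlgebra.mu ℤ W' V =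
        ∑ W' ∈ Finset.Icc W V, ∑ S ∈ (Finset.univ : Finset (Finset (Fin m))).filter
        (fun S => IsNBC A g S ∧ flatOf A g S = (W' : Set (Fin n → F))), (-1 : ℤ) ^ S.card := by
      rw [h1, h2]
      by_cases hc : W = V
      · rw [if_pos hc, if_pos (hiff.1 hc)]
      · rw [if_neg hc, if_neg (fun h => hc (hiff.2 h))]
    rw [← Finset.insert_erase (Finset.left_mem_Icc.2 hWV),
      Finset.sum_insert (Finset.notMem_erase _ _),
      Finset.sum_insert (Finset.notMem_erase _ _)] at h5
    have h6 : ∑ W' ∈ (Finset.Icc W V).erase W, IncidenceAlgebra.mu ℤ W' V =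
        ∑ W' ∈ (Finset.Icc W V).erase W, ∑ S ∈ (Finset.univ : Finset (Finset (Fin m))).filter
        (fun S => IsNBC A g S ∧ flatOf A g S = (W' : Set (Fin n → F))), (-1 : ℤ) ^ S.card := by
      refine Finset.sum_congr rfl (fun W' hW' => ih W' ?_)
      obtain ⟨hne, hmem⟩ := Finset.mem_erase.1 hW'
      exact lt_of_le_of_ne (Finset.mem_Icc.1 hmem).1 (Ne.symm hne)
    rw [h6] at h5
    exact add_right_cancel h5

open Classical in
/-- Whitney's theorem for affine arrangements. -/
lemma coeff_chi (A : Matrix (Fin m) (Fin n) F) (hrows : ∀ i, A i ≠ 0) (g : Fin m → F)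
    (k : ℕ) (hk : k ≤ n) :
    (-1 : ℤ) ^ k * (chi F Set.univ (Haff A g)).coeff (n - k) =
      (((Finset.univ : Finset (Finset (Fin m))).filter
        (fun S => IsNBC A g S ∧ S.card = k)).card : ℤ) := by
  unfold chi
  rw [dif_pos Set.univ_nonempty]
  rw [Polynomial.finsetSum_coeff]
  simp_rw [Polynomial.coeff_C_mul, Polynomial.coeff_X_pow]
  letI : Fintype ↥(flats Set.univ (Haff A g)) := (flats_finite Set.univ (Haff A g)).fintype
  letI : LocallyFiniteOrder ↥(flats Set.univ (Haff A g)) := Fintype.toLocallyFiniteOrder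
  have hmu := mu_eq A hrows g ⟨Set.univ, self_mem_flats (Haff A g) Set.univ_nonempty⟩ rfl
  have hsum := sum_fiber A g Finset.univ
    (fun W S => (-1 : ℤ) ^ S.card * (if n - k = adim F W then 1 else 0))
  have hstep : ∀ W : ↥(flats Set.univ (Haff A g)),
      IncidenceAlgebra.mu ℤ W
        ⟨Set.univ, self_mem_flats (Haff A g) Set.univ_nonempty⟩ *
        (if n - k = adim F (W : Set (Fin n → F)) then 1 else 0) =
      ∑ S ∈ (Finset.univ : Finset (Finset (Fin m))).filter
        (fun S => IsNBC A g S ∧ flatOf A g S = (W : Set (Fin n → F))),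
        (-1 : ℤ) ^ S.card * (if n - k = adim F (W : Set (Fin n → F)) then 1 else 0) := by
    intro W
    rw [hmu W, Finset.sum_mul]
  rw [Finset.sum_congr rfl (fun W _ => hstep W), hsum, Finset.mul_sum, Finset.card_filter,
    Finset.sum_filter]
  push_cast
  refine Finset.sum_congr rfl (fun S _ => ?_)
  by_cases hS : IsNBC A g S
  · rw [if_pos ⟨hS, ⟨_, nbc_flat hS⟩, Finset.mem_univ _, rfl⟩]
    have hd := (nbc_geom A g S hS.1).2
    by_cases hc : S.card = k
    · rw [if_pos (by omega), if_pos ⟨hS, hc⟩, hc, mul_one, ← mul_pow]; simp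
    · rw [if_neg (by omega), if_neg (fun h => hc h.2)]; simp
  · rw [if_neg (fun h => hS h.1), if_neg (fun h => hS h.1)]

end Helpers

/-- **Theorem 3.2, Uniform Comparison Theorem.** Writing
`χ(A_g, t) = ∑ (-1)^k a_k(g) t^(n-k)`, i.e. `a_k(g) = (-1)^k · coeff_{n-k} χ(A_g, t)`,
if `C_h ⊆ C_g` then `a_k(g) ≤ a_k(h)` for all `k`. -/
theorem coefficient_comparison
    (hm : 0 < m) (hn : 0 < n) (A : Matrix (Fin m) (Fin n) F) (hrows : ∀ i, A i ≠ 0)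
    (g h : Fin m → F) (hC : Cset A h ⊆ Cset A g) :
    ∀ k ≤ n,
      (-1 : ℤ) ^ k * (chi F Set.univ (Haff A g)).coeff (n - k) ≤
        (-1 : ℤ) ^ k * (chi F Set.univ (Haff A h)).coeff (n - k) := by
  classical
  intro k hk
  rw [coeff_chi A hrows g k hk, coeff_chi A hrows h k hk]
  have hsub : (Finset.univ : Finset (Finset (Fin m))).filter
      (fun S => IsNBC A g S ∧ S.card = k) ⊆
      (Finset.univ : Finset (Finset (Fin m))).filter (fun S => IsNBC A h S ∧ S.card = k) := by
    intro S hS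
    obtain ⟨h0, h1, h2⟩ := Finset.mem_filter.1 hS
    exact Finset.mem_filter.2 ⟨h0, ⟨h1.1, fun C hCh => h1.2 C (hC hCh)⟩, h2⟩
  exact_mod_cast Finset.card_le_card hsub
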